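/- Let G be a connected loopless graph with root vertex g, let q ∈ K, and take Hecke parameters q_e = q for all edges e. Then: (i) for every k ∈ ℕ, the K-linear span of all products (X_1^T)^{α_1}⋯(X_n^T)^{α_n} with α_1 + … + α_n ≤ k equals the intersection of Ψ^T_{G,q} with the image in Φ^T_{G,q} of the polynomials of total degree ≤ k in the u_e; and (ii) for every k ∈ ℕ, dim_K F_k(Ψ^T_{G,q}) = dim_K F_k(Ψ^T_{G,0}), i.e., the Hilbert polynomial of Ψ^T_{G,q} coincides with that of the undeformed tree-counting algebra C^T_G = Ψ^T_{G,0}. -/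

import Mathlib

open MvPolynomial

set_option synthInstance.maxHeartbeats 1000000
set_option maxHeartbeats 1000000

noncomputable section

/-- The edges of the cut oriented out of `I` (small endpoint in `I`). -/
def cutOut {n : ℕ} {E : Type*} [Fintype E] (a b : E → Fin n) (I : Finset (Fin n)) :
    Finset E :=
  Finset.univ.filter fun e => a e ∈ I ∧ b e ∉ I

/-- The edges of the cut oriented into `I` (large endpoint in `I`). -/
def cutIn {n : ℕ} {E : Type*} [Fintype E] (a b : E → Fin n) (I : Finset (Fin n)) :
    Finset E :=
  Finset.univ.filter fun e => b e ∈ I ∧ a e ∉ I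

/-- The cut polynomial `f_I`. -/
def fI {K : Type*} [Field K] {n : ℕ} {E : Type*} [Fintype E]
    (a b : E → Fin n) (q : E → K) (I : Finset (Fin n)) : MvPolynomial E K :=
  (∏ e ∈ cutOut a b I, X e) * ∏ e ∈ cutIn a b I, (X e - C (q e))

/-- The graph `G` is connected. -/
def IsConnectedGraph {n : ℕ} {E : Type*} (a b : E → Fin n) : Prop :=
  ∀ x y : Fin n,
    Relation.ReflTransGen (fun u w => ∃ e, (a e = u ∧ b e = w) ∨ (a e = w ∧ b e = u)) x y

/-- The ideal of relations of `Φ^T_{G,Q}`: the relations `u_e^2 = q_e u_e` together with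
the cut relations `f_I = 0` for proper subsets `I` containing the root `g`. -/
def relIdealT (K : Type*) [Field K] {n : ℕ} (E : Type*) [Fintype E]
    (a b : E → Fin n) (q : E → K) (g : Fin n) : Ideal (MvPolynomial E K) :=
  Ideal.span ((Set.range fun e : E => (X e) ^ 2 - C (q e) * X e) ∪
    {p | ∃ I : Finset (Fin n), g ∈ I ∧ I ≠ Finset.univ ∧ p = fI a b q I})

/-- The algebra `Φ^T_{G,Q}`. -/
abbrev PhiT (K : Type*) [Field K] {n : ℕ} (E : Type*) [Fintype E]
    (a b : E → Fin n) (q : E → K) (g : Fin n) : Type _ :=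
  MvPolynomial E K ⧸ relIdealT K E a b q g

/-- The generator `X_i^T`. -/
def XT (K : Type*) [Field K] {n : ℕ} {E : Type*} [Fintype E]
    (a b : E → Fin n) (q : E → K) (g : Fin n) (i : Fin n) : PhiT K E a b q g :=
  Ideal.Quotient.mk _
    ((∑ e ∈ Finset.univ.filter fun e => a e = i, X e) -
      ∑ e ∈ Finset.univ.filter fun e => b e = i, X e)

/-- The `Q`-deformation `Ψ^T_{G,Q}` of the algebra counting spanning trees. -/
def PsiT (K : Type*) [Field K] {n : ℕ} {E : Type*} [Fintype E]
    (a b : E → Fin n) (q : E → K) (g : Fin n) : Subalgebra K (PhiT K E a b q g) :=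
  Algebra.adjoin K (Set.range (XT K a b q g))

/-- The `k`-th piece of the filtration of `Ψ^T_{G,Q}` induced by the generators `X_i^T`. -/
def FkT (K : Type*) [Field K] {n : ℕ} {E : Type*} [Fintype E]
    (a b : E → Fin n) (q : E → K) (g : Fin n) (k : ℕ) : Submodule K (PhiT K E a b q g) :=
  Submodule.span K
    {y | ∃ α : Fin n → ℕ, (∑ i, α i) ≤ k ∧ y = ∏ i, (XT K a b q g i) ^ (α i)}



/-- every cut is crossed by an edge of `B` -/
def GoodIn {V E : Type*} [Fintype V] [DecidableEq V] (a b : E → V) (g : V) (B : Finset E) : Prop :=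
  ∀ I : Finset V, g ∈ I → I ≠ Finset.univ → ∃ e ∈ B, ¬ (a e ∈ I ↔ b e ∈ I)

/-- the central P-space -/
def Psp (K : Type*) [Field K] {V E : Type*} [Fintype V] [DecidableEq V] [DecidableEq E]
    (a b : E → V) (g : V) (A : Finset E) : Submodule K (MvPolynomial V K) :=
  Submodule.span K {r | ∃ T : Finset E, T ⊆ A ∧ GoodIn a b g (A \ T) ∧
    r = ∏ e ∈ T, (X (a e) - X (b e))}

/-- score vectors, by inequalities -/
def Sc {V E : Type*} [Fintype V] [DecidableEq V] (a b : E → V) (g : V) (A : Finset E)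
    (s : V → ℤ) : Prop :=
  ∑ v, s v = A.card ∧ ∀ I : Finset V, ∑ v ∈ I, s v + (if g ∈ I ∧ I ≠ Finset.univ then 1 else 0) ≤
    ((A.filter fun e => a e ∈ I ∨ b e ∈ I).card : ℤ)

lemma Psp_finite (K : Type*) [Field K] {V E : Type*} [Fintype V] [DecidableEq V] [DecidableEq E]
    (a b : E → V) (g : V) (A : Finset E) : Module.Finite K (Psp K a b g A) := by
  classical
  apply FiniteDimensional.span_of_finite
  refine ((A.powerset.image fun T => ∏ e ∈ T, (X (a e) - X (b e) : MvPolynomial V K)).finite_toSet).subset ?_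
  rintro r ⟨T, hT, -, rfl⟩
  simp only [Finset.coe_image, Set.mem_image, Finset.mem_coe, Finset.mem_powerset]
  exact ⟨T, hT, rfl⟩

lemma GoodIn.mono {V E : Type*} [Fintype V] [DecidableEq V] {a b : E → V} {g : V} {B C : Finset E}
    (h : GoodIn a b g B) (hBC : B ⊆ C) : GoodIn a b g C := by
  intro I h1 h2
  obtain ⟨e, he, h3⟩ := h I h1 h2
  exact ⟨e, hBC he, h3⟩

lemma card_filter_insert' {E : Type*} [DecidableEq E] (A : Finset E) (e : E) (he : e ∉ A)
    (p : E → Prop) [DecidablePred p] :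
    (((insert e A).filter p).card : ℤ) = (A.filter p).card + (if p e then 1 else 0) := by
  rw [Finset.filter_insert]
  split_ifs with h
  · rw [Finset.card_insert_of_notMem (by simp [he])]; push_cast; ring
  · simp

lemma sum_sub_single {V : Type*} [DecidableEq V] (s : V → ℤ) (x : V) (I : Finset V) :
    ∑ v ∈ I, (s - Pi.single x 1 : V → ℤ) v = ∑ v ∈ I, s v - (if x ∈ I then 1 else 0) := by
  simp [Finset.sum_sub_distrib, Finset.sum_pi_single']

lemma finrank_delete_contract {K : Type*} [Field K] {V V' E : Type*} [Fintype V] [DecidableEq V]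
    [Fintype V'] [DecidableEq V'] [DecidableEq E]
    (a b : E → V) (g : V) (A : Finset E) (e : E) (he : e ∉ A) (hxy : a e ≠ b e)
    (π : V → V') (hπ : ∀ v w, π v = π w ↔ v = w ∨ (v = a e ∧ w = b e) ∨ (v = b e ∧ w = a e)) :
    Module.finrank K (Psp K a b g A) + Module.finrank K (Psp K (π ∘ a) (π ∘ b) (π g) A) ≤
      Module.finrank K (Psp K a b g (insert e A)) := by
  have := Psp_finite K a b g (insert e A)
  have := Psp_finite K a b g A
  have := Psp_finite K (π ∘ a) (π ∘ b) (π g) A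
  let f : MvPolynomial V K →ₗ[K] MvPolynomial V' K := (rename π).toLinearMap
  let M : MvPolynomial V K →ₗ[K] MvPolynomial V K := LinearMap.mulLeft K (X (a e) - X (b e))
  have hM : Function.Injective M := by
    have hne : (X (a e) - X (b e) : MvPolynomial V K) ≠ 0 := by
      rw [sub_ne_zero]; exact fun h => hxy (X_injective h)
    intro p r h
    exact mul_left_cancel₀ hne h
  have h1 : (Psp K a b g A).map M ≤ Psp K a b g (insert e A) := by
    rw [Psp, Submodule.map_span_le]
    rintro _ ⟨T, hT, hG, rfl⟩
    apply Submodule.subset_span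
    refine ⟨insert e T, Finset.insert_subset_insert _ hT, ?_, ?_⟩
    · convert hG using 1
      ext c
      simp only [Finset.mem_sdiff, Finset.mem_insert]
      constructor
      · rintro ⟨h | h, h2⟩
        · exact absurd (Or.inl h) h2
        · exact ⟨h, fun h3 => h2 (Or.inr h3)⟩
      · rintro ⟨h, h2⟩
        refine ⟨Or.inr h, ?_⟩
        rintro (h3 | h3)
        · exact he (h3 ▸ h)
        · exact h2 h3
    · rw [Finset.prod_insert (fun h => he (hT h))]
      rfl
  have h2 : Psp K (π ∘ a) (π ∘ b) (π g) A ≤ (Psp K a b g (insert e A)).map f := by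
    rw [Psp, Submodule.span_le]
    rintro _ ⟨T, hT, hG, rfl⟩
    refine ⟨∏ e ∈ T, (X (a e) - X (b e)), ?_, ?_⟩
    · apply Submodule.subset_span
      refine ⟨T, hT.trans (Finset.subset_insert _ _), ?_, rfl⟩
      intro I hgI hI
      by_cases hc : a e ∈ I ↔ b e ∈ I
      · have key : ∀ v, π v ∈ I.image π ↔ v ∈ I := by
          intro v
          rw [Finset.mem_image]
          constructor
          · rintro ⟨w, hw, hwv⟩
            rw [hπ] at hwv
            rcases hwv with rfl | ⟨rfl, rfl⟩ | ⟨rfl, rfl⟩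
            · exact hw
            · exact hc.1 hw
            · exact hc.2 hw
          · exact fun h => ⟨v, h, rfl⟩
        obtain ⟨c, hc1, hc2⟩ := hG (I.image π) ((key g).2 hgI) (by
          intro h
          apply hI
          ext v
          simp only [Finset.mem_univ, iff_true]
          rw [← key, h]; simp)
        simp only [Function.comp, key] at hc2
        exact ⟨c, Finset.sdiff_subset_sdiff (Finset.subset_insert _ _) le_rfl hc1, hc2⟩
      · refine ⟨e, ?_, hc⟩
        simp only [Finset.mem_sdiff, Finset.mem_insert, true_or, true_and]
        exact fun h => he (hT h)
    · simp [f, map_prod]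
  have h3 : (Psp K a b g A).map M ≤ LinearMap.ker f := by
    rintro _ ⟨p, -, rfl⟩
    have : π (a e) = π (b e) := by rw [hπ]; simp
    simp [f, M, this]
  let f' := f.domRestrict (Psp K a b g (insert e A))
  have h4 := LinearMap.finrank_range_add_finrank_ker f'
  have h5 : Module.finrank K (Psp K (π ∘ a) (π ∘ b) (π g) A) ≤ Module.finrank K (LinearMap.range f') := by
    apply Submodule.finrank_mono
    rw [LinearMap.range_domRestrict]
    exact h2
  have h6 : Module.finrank K (Psp K a b g A) ≤ Module.finrank K (LinearMap.ker f') := by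
    let j : Psp K a b g A →ₗ[K] LinearMap.ker f' :=
      LinearMap.codRestrict _ (LinearMap.codRestrict _ (M.domRestrict _)
        (fun p => h1 ⟨p, p.2, rfl⟩)) (fun p => by
          rw [LinearMap.mem_ker]
          exact LinearMap.mem_ker.1 (h3 ⟨p, p.2, rfl⟩))
    apply LinearMap.finrank_le_finrank_of_injective (f := j)
    intro p r h
    have : M p = M r := congrArg (fun z : LinearMap.ker f' => ((z : Psp K a b g (insert e A)) : MvPolynomial V K)) h
    exact Subtype.ext (hM this)
  omega

lemma sum_push {V V' : Type*} [Fintype V] [DecidableEq V] [Fintype V'] [DecidableEq V']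
    (π : V → V') (s : V → ℤ) (I : Finset V') :
    ∑ v' ∈ I, ∑ v with π v = v', s v = ∑ v with π v ∈ I, s v := by
  rw [← Finset.sum_fiberwise_of_maps_to (s := Finset.univ.filter fun v => π v ∈ I) (t := I) (g := π) (by simp)]
  apply Finset.sum_congr rfl
  intro v' hv'
  apply Finset.sum_congr _ (fun _ _ => rfl)
  ext v
  simp only [Finset.mem_filter, Finset.mem_univ, true_and]
  constructor
  · rintro rfl; exact ⟨hv', rfl⟩
  · exact fun h => h.2

theorem card_le_finrank_Psp (K : Type*) [Field K] {E : Type*} [DecidableEq E] (A : Finset E) :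
    ∀ {V : Type} [Fintype V] [DecidableEq V] (a b : E → V) (g : V) (F : Finset (V → ℤ)),
      (∀ s ∈ F, Sc a b g A s) → F.card ≤ Module.finrank K (Psp K a b g A) := by
  induction A using Finset.induction_on with
  | empty =>
    intro V _ _ a b g F hF
    have := Psp_finite K a b g ∅
    rcases F.eq_empty_or_nonempty with rfl | ⟨s0, hs0⟩
    · simp
    have hz : ∀ s ∈ F, s = 0 := by
      intro s hs
      obtain ⟨h1, h2⟩ := hF s hs
      have h3 : ∀ v, s v ≤ 0 := by
        intro v
        have := h2 {v}
        simp only [Finset.sum_singleton, Finset.filter_empty, Finset.card_empty] at this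
        split_ifs at this <;> push_cast at this <;> linarith
      simp only [Finset.card_empty, Nat.cast_zero] at h1
      have := (Finset.sum_eq_zero_iff_of_nonpos (fun v _ => h3 v)).1 h1
      ext v; exact this v (Finset.mem_univ v)
    have hc : F.card ≤ 1 := Finset.card_le_one.2 (fun s hs t ht => by rw [hz s hs, hz t ht])
    refine hc.trans ?_
    have h1 : (1 : MvPolynomial V K) ∈ Psp K a b g ∅ := by
      apply Submodule.subset_span
      refine ⟨∅, le_rfl, ?_, by simp⟩
      intro I hg hI
      exfalso
      have := (hF s0 hs0).2 I
      rw [hz s0 hs0] at this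
      simp [hg, hI] at this
    rw [Nat.one_le_iff_ne_zero, ← Nat.pos_iff_ne_zero, Module.finrank_pos_iff_exists_ne_zero]
    exact ⟨⟨1, h1⟩, fun h => one_ne_zero (congrArg Subtype.val h)⟩
  | insert e A he ih =>
    intro V _ _ a b g F hF
    have := Psp_finite K a b g (insert e A)
    by_cases hxy : a e = b e
    · have h1 : F.card = (F.image fun s => s - Pi.single (a e) 1).card := by
        rw [Finset.card_image_of_injective]
        exact fun s t h => sub_left_injective h
      rw [h1]
      refine (ih a b g _ ?_).trans (Submodule.finrank_mono ?_)
      · intro t ht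
        rw [Finset.mem_image] at ht
        obtain ⟨s, hs, rfl⟩ := ht
        obtain ⟨h1, h2⟩ := hF s hs
        constructor
        · rw [sum_sub_single, h1, Finset.card_insert_of_notMem he]; simp
        · intro I
          have := h2 I
          rw [card_filter_insert' _ _ he, ← hxy] at this
          simp only [or_self] at this
          rw [sum_sub_single]
          linarith
      · apply Submodule.span_mono
        rintro _ ⟨T, hT, hG, rfl⟩
        exact ⟨T, hT.trans (Finset.subset_insert _ _), hG.mono
          (Finset.sdiff_subset_sdiff (Finset.subset_insert _ _) le_rfl), rfl⟩
    · let π : V → {v : V // v ≠ b e} := fun v => if h : v = b e then ⟨a e, hxy⟩ else ⟨v, h⟩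
      have hπb : π (b e) = ⟨a e, hxy⟩ := by simp [π]
      have hπn : ∀ v (h : v ≠ b e), π v = ⟨v, h⟩ := by intro v h; simp [π, h]
      have hπ : ∀ v w, π v = π w ↔ v = w ∨ (v = a e ∧ w = b e) ∨ (v = b e ∧ w = a e) := by
        intro v w
        by_cases hv : v = b e
        · subst hv
          by_cases hw : w = b e
          · subst hw; simp
          · rw [hπb, hπn w hw, Subtype.mk.injEq]
            grind
        · by_cases hw : w = b e
          · subst hw
            rw [hπb, hπn v hv, Subtype.mk.injEq]
            grind
          · rw [hπn v hv, hπn w hw, Subtype.mk.injEq]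
            grind
      have hsurj : Function.Surjective π := fun v => ⟨v.1, hπn v.1 v.2⟩
      classical
      have hdc := finrank_delete_contract (K := K) a b g A e he hxy π hπ
      refine le_trans ?_ hdc
      let d : V → ℤ := Pi.single (a e) 1 - Pi.single (b e) 1
      let R : (V → ℤ) → Prop := fun s => ∃ k : ℤ, 0 < k ∧ s + k • d ∈ F
      let cc : (V → ℤ) → ({v : V // v ≠ b e} → ℤ) := 
        fun s => (fun v' => ∑ v with π v = v', s v) - Pi.single (π (a e)) 1
      rw [← Finset.card_filter_add_card_filter_not (s := F) R]
      have hsd : ∀ (k : ℤ) (I : Finset V), ∑ v ∈ I, (k • d) v = 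
          k * ((if a e ∈ I then 1 else 0) - (if b e ∈ I then 1 else 0)) := by
        intro k I
        simp only [d, Pi.smul_apply, Pi.sub_apply, smul_eq_mul]
        rw [← Finset.mul_sum, Finset.sum_sub_distrib, Finset.sum_pi_single', Finset.sum_pi_single']
      apply add_le_add
      · have h1 : (F.filter R).card = ((F.filter R).image fun s => s - Pi.single (b e) 1).card := by
          rw [Finset.card_image_of_injective]
          exact fun s t h => sub_left_injective h
        rw [h1]
        refine (ih a b g _ ?_)
        intro t ht
        rw [Finset.mem_image] at ht
        obtain ⟨s, hs, rfl⟩ := ht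
        rw [Finset.mem_filter] at hs
        obtain ⟨hs, k, hk, hs'⟩ := hs
        obtain ⟨h1, h2⟩ := hF s hs
        obtain ⟨-, h2'⟩ := hF _ hs'
        constructor
        · rw [sum_sub_single, h1, Finset.card_insert_of_notMem he]; simp
        · intro I
          have := h2 I
          have h3 := h2' I
          rw [card_filter_insert' _ _ he] at this h3
          simp only [Pi.add_apply] at h3
          rw [Finset.sum_add_distrib, hsd] at h3
          rw [sum_sub_single]
          by_cases hx : a e ∈ I <;> by_cases hy : b e ∈ I <;> 
            simp only [hx, hy, if_true, if_false, or_true, true_or, or_false, false_or] at this h3 ⊢ <;> linarith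
      · have h1 : (F.filter fun s => ¬ R s).card = ((F.filter fun s => ¬ R s).image cc).card := by
          rw [Finset.card_image_of_injOn]
          intro s hs t ht hst
          simp only [Finset.coe_filter, Set.mem_ofPred_eq] at hs ht
          have hst' : ∀ v' : {v : V // v ≠ b e}, ∑ v with π v = v', s v = ∑ v with π v = v', t v := by
            intro v'
            have := congrFun hst v'
            simpa [cc] using this
          have hne : ∀ v, v ≠ a e → v ≠ b e → s v = t v := by
            intro v hv1 hv2
            have := hst' (π v)
            have hf : (Finset.univ.filter fun w => π w = π v) = {v} := by
              ext w
              simp only [Finset.mem_filter, Finset.mem_univ, true_and, Finset.mem_singleton, hπ]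
              grind
            rw [hf] at this
            simpa using this
          have hab : s (a e) + s (b e) = t (a e) + t (b e) := by
            have := hst' (π (a e))
            have hf : (Finset.univ.filter fun w => π w = π (a e)) = {a e, b e} := by
              ext w
              simp only [Finset.mem_filter, Finset.mem_univ, true_and, Finset.mem_singleton, hπ, Finset.mem_insert]
              grind
            rw [hf, Finset.sum_pair hxy, Finset.sum_pair hxy] at this
            exact this
          have hgen : ∀ s t : V → ℤ, (∀ v, v ≠ a e → v ≠ b e → s v = t v) → 
              s (a e) + s (b e) = t (a e) + t (b e) → s = t + (s (a e) - t (a e)) • d := by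
            intro s t hne hab
            ext v
            by_cases h1 : v = a e
            · subst h1; simp [d, hxy]
            · by_cases h2 : v = b e
              · subst h2
                simp [d, Ne.symm hxy]; linarith
              · simp [d, h1, h2, hne v h1 h2]
          rcases lt_trichotomy (s (a e)) (t (a e)) with h | h | h
          · exfalso
            apply hs.2
            refine ⟨t (a e) - s (a e), by linarith, ?_⟩
            rw [← hgen t s (fun v h1 h2 => (hne v h1 h2).symm) hab.symm]
            exact ht.1
          · rw [hgen s t hne hab, h]; simp
          · exfalso
            apply ht.2
            refine ⟨s (a e) - t (a e), by linarith, ?_⟩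
            rw [← hgen s t hne hab]
            exact hs.1
        rw [h1]
        refine ih _ _ _ _ ?_
        intro t ht
        rw [Finset.mem_image] at ht
        obtain ⟨s, hs, rfl⟩ := ht
        rw [Finset.mem_filter] at hs
        obtain ⟨h1, h2⟩ := hF s hs.1
        constructor
        · rw [sum_sub_single, sum_push]
          simp [h1, Finset.card_insert_of_notMem he]
        · intro I
          have h3 := h2 (Finset.univ.filter fun v => π v ∈ I)
          rw [card_filter_insert' _ _ he] at h3
          rw [sum_sub_single, sum_push]
          have h4 : (Finset.univ.filter fun v => π v ∈ I) = Finset.univ ↔ I = Finset.univ := by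
            rw [Finset.filter_eq_self]
            constructor
            · intro h
              ext v'
              obtain ⟨v, rfl⟩ := hsurj v'
              simp [h v]
            · rintro rfl; simp
          have h5 : π (b e) = π (a e) := by rw [hπ]; simp
          simp only [Finset.mem_filter, Finset.mem_univ, true_and, ne_eq, h4, h5, or_self] at h3
          simp only [Function.comp, ne_eq]
          linarith


/-- exponent of the squarefree monomial -/
def ind {E : Type*} (T : Finset E) : E →₀ ℕ := ∑ e ∈ T, Finsupp.single e 1

lemma ind_apply {E : Type*} [DecidableEq E] (T : Finset E) (e : E) :
    ind T e = if e ∈ T then 1 else 0 := by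
  simp [ind, Finsupp.finsetSum_apply, Finsupp.single_apply]

lemma ind_degree {E : Type*} (T : Finset E) : (ind T).degree = T.card := by
  simp [ind, map_sum]

lemma monomial_ind {K E : Type*} [Field K] (T : Finset E) :
    (monomial (ind T) (1 : K)) = ∏ e ∈ T, X e := by
  rw [ind, monomial_sum_one]; rfl

/-- distance function -/
lemma exists_dist {V E : Type*} [Fintype V] [DecidableEq V] (a b : E → V) (g : V)
    (B : Finset E) (hB : GoodIn a b g B) :
    ∃ d : V → ℕ, ∀ v, v ≠ g → ∃ e ∈ B, (a e = v ∧ d (b e) < d v) ∨ (b e = v ∧ d (a e) < d v) := by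
  have key : ∀ k : ℕ, ∀ I : Finset V, (Finset.univ \ I).card = k → g ∈ I → 
      (∃ d : V → ℕ, ∀ v ∈ I, v ≠ g → ∃ e ∈ B, (a e = v ∧ b e ∈ I ∧ d (b e) < d v) ∨ 
        (b e = v ∧ a e ∈ I ∧ d (a e) < d v)) → 
      ∃ d : V → ℕ, ∀ v, v ≠ g → ∃ e ∈ B, (a e = v ∧ d (b e) < d v) ∨ (b e = v ∧ d (a e) < d v) := by
    intro k
    induction k with
    | zero =>
      rintro I hI - ⟨d, hd⟩
      refine ⟨d, fun v hv => ?_⟩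
      have : v ∈ I := by
        by_contra h
        have : v ∈ Finset.univ \ I := by simp [h]
        rw [Finset.card_eq_zero.1 hI] at this
        simp at this
      obtain ⟨e, he, h⟩ := hd v this hv
      exact ⟨e, he, by tauto⟩
    | succ k ih =>
      rintro I hI hg ⟨d, hd⟩
      obtain ⟨e, he, hc⟩ := hB I hg (by rintro rfl; simp at hI)
      have hvw : ∃ v w, v ∉ I ∧ w ∈ I ∧ ((a e = v ∧ b e = w) ∨ (b e = v ∧ a e = w)) := by
        by_cases h : a e ∈ I
        · exact ⟨b e, a e, by tauto, h, by tauto⟩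
        · exact ⟨a e, b e, h, by tauto, by tauto⟩
      obtain ⟨v, w, hv, hw, hevw⟩ := hvw
      apply ih (insert v I)
      · have : Finset.univ \ insert v I = (Finset.univ \ I).erase v := by
          ext; simp 
        rw [this, Finset.card_erase_of_mem (by simp [hv]), hI]; rfl
      · simp [hg]
      · refine ⟨Function.update d v (d w + 1), ?_⟩
        have hu : ∀ z ∈ I, Function.update d v (d w + 1) z = d z := by
          intro z hz
          exact Function.update_of_ne (by rintro rfl; exact hv hz) _ _
        intro z hz hzg
        rw [Finset.mem_insert] at hz
        rcases hz with rfl | hz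
        · refine ⟨e, he, ?_⟩
          rcases hevw with ⟨h1, h2⟩ | ⟨h1, h2⟩
          · left; refine ⟨h1, by simp [h2, hw], ?_⟩
            rw [h2, hu w hw]; simp
          · right; refine ⟨h1, by simp [h2, hw], ?_⟩
            rw [h2, hu w hw]; simp
        · obtain ⟨e', he', h | h⟩ := hd z hz hzg
          · exact ⟨e', he', Or.inl ⟨h.1, by simp [h.2.1], by rw [hu z hz, hu _ h.2.1]; exact h.2.2⟩⟩
          · exact ⟨e', he', Or.inr ⟨h.1, by simp [h.2.1], by rw [hu z hz, hu _ h.2.1]; exact h.2.2⟩⟩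
  exact key _ {g} rfl (by simp) ⟨fun _ => 0, fun v hv hvg => absurd (by simpa using hv) hvg⟩

lemma eval_relIdeal {K : Type*} [Field K] {n : ℕ} {E : Type*} [Fintype E]
    (a b : E → Fin n) (g : Fin n) (q : E → K) (u : E → K) (hu : ∀ e, u e = 0 ∨ u e = q e)
    (hI : ∀ I : Finset (Fin n), g ∈ I → I ≠ Finset.univ → eval u (fI a b q I) = 0)
    (f : MvPolynomial E K) (hf : f ∈ relIdealT K E a b q g) : eval u f = 0 := by
  have : relIdealT K E a b q g ≤ RingHom.ker (eval u) := by
    rw [relIdealT, Ideal.span_le]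
    rintro p (⟨e, rfl⟩ | ⟨I, h1, h2, rfl⟩)
    · simp only [SetLike.mem_coe, RingHom.mem_ker]
      rcases hu e with h | h <;> simp [h] <;> ring
    · exact hI I h1 h2
  exact this hf

lemma eval_fI_eq_zero {K : Type*} [Field K] {n : ℕ} {E : Type*} [Fintype E]
    (a b : E → Fin n) (q : E → K) (u : E → K) (I : Finset (Fin n)) :
    eval u (fI a b q I) = 0 ↔ (∃ e, a e ∈ I ∧ b e ∉ I ∧ u e = 0) ∨ 
      (∃ e, b e ∈ I ∧ a e ∉ I ∧ u e = q e) := by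
  simp only [fI, map_mul, map_prod, mul_eq_zero, Finset.prod_eq_zero_iff, eval_X, map_sub, eval_C,
    sub_eq_zero, cutOut, cutIn, Finset.mem_filter, Finset.mem_univ, true_and, and_assoc]

lemma base_good {K : Type*} [Field K] {n : ℕ} {E : Type*} [Fintype E] [DecidableEq E]
    (a b : E → Fin n) (g : Fin n) (q : K) (B : Finset E) (hB : GoodIn a b g B) :
    ∃ w : E → K, (∀ e, w e = 0 ∨ w e = q) ∧ ∀ u : E → K, (∀ e ∈ B, u e = w e) → 
      ∀ I : Finset (Fin n), g ∈ I → I ≠ Finset.univ → eval u (fI a b (fun _ => q) I) = 0 := by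
  obtain ⟨d, hd⟩ := exists_dist a b g B hB
  refine ⟨fun e => if d (b e) < d (a e) then q else 0, fun e => by dsimp only; split_ifs <;> simp, ?_⟩
  intro u hu I hg hI
  rw [eval_fI_eq_zero]
  have hne : (Finset.univ \ I).Nonempty := by
    rw [Finset.nonempty_iff_ne_empty, ne_eq, Finset.sdiff_eq_empty_iff_subset, Finset.univ_subset_iff]
    exact hI
  obtain ⟨v, hv, hmin⟩ := Finset.exists_min_image _ d hne
  simp only [Finset.mem_sdiff, Finset.mem_univ, true_and] at hv hmin
  have hin : ∀ w, d w < d v → w ∈ I := by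
    intro w hw
    by_contra h
    exact absurd (hmin w h) (by omega)
  obtain ⟨e, he, ⟨rfl, h⟩ | ⟨rfl, h⟩⟩ := hd v (by rintro rfl; exact hv hg)
  · right
    exact ⟨e, hin _ h, hv, (hu e he).trans (if_pos h)⟩
  · left
    exact ⟨e, hin _ h, hv, (hu e he).trans (if_neg (by omega))⟩

/-- alternating sums -/
lemma alt_sum {K : Type*} [Field K] {E : Type*} [Fintype E] [DecidableEq E]
    (q : K) (T : Finset E) (w : E → K) (f : MvPolynomial E K) (hf : f.totalDegree ≤ T.card) :
    ∑ U ∈ T.powerset, (-1) ^ (T \ U).card * 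
      eval (fun e => if e ∈ T then (if e ∈ U then q else 0) else w e) f = q ^ T.card * coeff (ind T) f := by
  have h1 : ∀ m : E →₀ ℕ, m.degree ≤ T.card → ∑ U ∈ T.powerset, (-1) ^ (T \ U).card * 
      ∏ e, (fun e => if e ∈ T then (if e ∈ U then q else 0) else w e) e ^ m e = 
      if ind T = m then q ^ T.card else 0 := by
    intro m hm
    have h2 : ∀ U ∈ T.powerset, (-1) ^ (T \ U).card * 
      ∏ e, (fun e => if e ∈ T then (if e ∈ U then q else 0) else w e) e ^ m e = 
        (∏ e ∈ Tᶜ, w e ^ m e) * ((∏ e ∈ U, q ^ m e) * ∏ e ∈ T \ U, (- (0 : K) ^ m e)) := by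
      intro U hU
      rw [Finset.mem_powerset] at hU
      rw [← Finset.prod_mul_prod_compl T, Finset.prod_neg, ← Finset.prod_sdiff hU]
      have e1 : ∏ e ∈ T \ U, (fun e => if e ∈ T then (if e ∈ U then q else 0) else w e) e ^ m e = 
          ∏ e ∈ T \ U, (0 : K) ^ m e := by
        apply Finset.prod_congr rfl
        intro e he
        rw [Finset.mem_sdiff] at he
        simp [he.1, he.2]
      have e2 : ∏ e ∈ U, (fun e => if e ∈ T then (if e ∈ U then q else 0) else w e) e ^ m e = 
          ∏ e ∈ U, q ^ m e := by
        apply Finset.prod_congr rfl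
        intro e he
        simp [hU he, he]
      have e3 : ∏ e ∈ Tᶜ, (fun e => if e ∈ T then (if e ∈ U then q else 0) else w e) e ^ m e = 
          ∏ e ∈ Tᶜ, w e ^ m e := by
        apply Finset.prod_congr rfl
        intro e he
        rw [Finset.mem_compl] at he
        simp [he]
      rw [e1, e2, e3]; ring
    rw [Finset.sum_congr rfl h2, ← Finset.mul_sum, ← Finset.prod_add]
    split_ifs with h
    · subst h
      have e1 : ∏ e ∈ Tᶜ, w e ^ (ind T) e = 1 := by
        apply Finset.prod_eq_one
        intro e he
        rw [Finset.mem_compl] at he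
        simp [ind_apply, he]
      have e2 : ∏ e ∈ T, (q ^ (ind T e) + - (0 : K) ^ (ind T e)) = ∏ e ∈ T, q := by
        apply Finset.prod_congr rfl
        intro e he
        simp [ind_apply, he]
      rw [e1, e2]; simp
    · have : ∃ e ∈ T, m e = 0 := by
        by_contra! hc
        apply h
        have hle : ind T ≤ m := by
          intro e
          rw [ind_apply]
          split_ifs with h3
          · exact Nat.one_le_iff_ne_zero.2 (hc e h3)
          · simp
        obtain ⟨r, rfl⟩ := exists_add_of_le hle
        rw [map_add, ind_degree] at hm
        have : r.degree = 0 := by omega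
        rw [Finsupp.degree_eq_zero_iff] at this
        simp [this]
      obtain ⟨e, he, hm0⟩ := this
      rw [Finset.prod_eq_zero he (by simp [hm0])]; simp
  simp only [eval_eq']
  calc _ = ∑ d ∈ f.support, coeff d f * (∑ U ∈ T.powerset, (-1) ^ (T \ U).card * 
      ∏ e, (fun e => if e ∈ T then (if e ∈ U then q else 0) else w e) e ^ d e) := by
        simp only [Finset.mul_sum]
        rw [Finset.sum_comm]
        apply Finset.sum_congr rfl; intro _ _
        apply Finset.sum_congr rfl; intro _ _
        ring
    _ = ∑ d ∈ f.support, coeff d f * (if ind T = d then q ^ T.card else 0) := by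
        apply Finset.sum_congr rfl; intro d hd
        rw [h1 d]
        refine le_trans ?_ hf
        rw [Finsupp.degree_eq_sum]
        have := le_totalDegree hd
        rwa [Finsupp.sum_fintype _ _ (by simp)] at this
    _ = _ := by
        simp only [mul_ite, mul_zero]
        rw [Finset.sum_ite_eq]
        split_ifs with h
        · ring
        · rw [notMem_support_iff.1 h]; ring

lemma coeff_zero_case {K : Type*} [Field K] {n : ℕ} {E : Type*} [Fintype E] [DecidableEq E]
    (a b : E → Fin n) (g : Fin n) (T : Finset E) (hT : GoodIn a b g (Finset.univ \ T))
    (f : MvPolynomial E K) (hf : f ∈ relIdealT K E a b (fun _ => 0) g) : coeff (ind T) f = 0 := by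
  have : ∀ c, coeff (ind T) (c * f) = 0 := by
    rw [relIdealT, Ideal.span] at hf
    induction hf using Submodule.span_induction with
    | zero => simp
    | add x y _ _ hx hy => intro c; rw [mul_add, coeff_add, hx, hy, add_zero]
    | smul r x _ hx => intro c; rw [smul_eq_mul, ← mul_assoc]; exact hx _
    | mem x hx =>
      intro c
      rcases hx with ⟨e, rfl⟩ | ⟨I, h1, h2, rfl⟩
      · simp only [map_zero, zero_mul, sub_zero]
        rw [X_pow_eq_monomial, coeff_mul_monomial', if_neg]
        intro h
        have := h e
        rw [ind_apply] at this
        simp only [Finsupp.single_eq_same] at this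
        split_ifs at this <;> omega
      · have : fI a b (fun _ => (0 : K)) I = monomial (ind (cutOut a b I) + ind (cutIn a b I)) 1 := by
          rw [← mul_one (1 : K), ← monomial_mul, monomial_ind, monomial_ind]
          simp [fI]
        rw [this, coeff_mul_monomial', if_neg]
        intro h
        obtain ⟨e, he, hc⟩ := hT I h1 h2
        simp only [Finset.mem_sdiff, Finset.mem_univ, true_and] at he
        have := h e
        rw [Finsupp.add_apply, ind_apply, ind_apply, ind_apply, if_neg he] at this
        by_cases h3 : a e ∈ I
        · have h4 : b e ∉ I := by tauto
          simp [cutOut, h3, h4] at this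
        · have h4 : b e ∈ I := by tauto
          simp [cutIn, h3, h4] at this
  simpa using this 1

theorem L1 {K : Type*} [Field K] {n : ℕ} {E : Type*} [Fintype E] [DecidableEq E]
    (a b : E → Fin n) (g : Fin n) (q : K) (T : Finset E) (hT : GoodIn a b g (Finset.univ \ T))
    (f : MvPolynomial E K) (hf : f ∈ relIdealT K E a b (fun _ => q) g) 
    (hd : f.totalDegree ≤ T.card) : coeff (ind T) f = 0 := by
  by_cases hq : q = 0
  · subst hq
    exact coeff_zero_case a b g T hT f hf
  obtain ⟨w, hw, hw2⟩ := base_good a b g q _ hT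
  have := alt_sum q T w f hd
  rw [Finset.sum_eq_zero] at this
  · simpa [hq] using this.symm
  intro U hU
  rw [eval_relIdeal a b g (fun _ => q) _ _ _ f hf, mul_zero]
  · intro e
    split_ifs <;> simp [hw]
  · apply hw2
    intro e he
    simp only [Finset.mem_sdiff, Finset.mem_univ, true_and] at he
    simp [he]

theorem L2 {K : Type*} [Field K] {n : ℕ} {E : Type*} [Fintype E] [DecidableEq E]
    (a b : E → Fin n) (g : Fin n)
    (f : MvPolynomial E K) (hf : ∀ T : Finset E, GoodIn a b g (Finset.univ \ T) → coeff (ind T) f = 0) :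
    f ∈ relIdealT K E a b (fun _ => 0) g := by
  rw [f.as_sum]
  apply Ideal.sum_mem
  intro m hm
  by_cases h : ∃ e, 2 ≤ m e
  · obtain ⟨e, he⟩ := h
    have h1 : monomial m (coeff m f) = monomial (m - Finsupp.single e 2) (coeff m f) * 
        (X e ^ 2 - C ((fun _ => 0 : E → K) e) * X e) := by
      simp only [map_zero, zero_mul, sub_zero]
      rw [X_pow_eq_monomial, monomial_mul, mul_one, tsub_add_cancel_of_le]
      simpa using he
    rw [h1]
    exact Ideal.mul_mem_left _ _ (Ideal.subset_span (Or.inl ⟨e, rfl⟩))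
  · push Not at h
    let T : Finset E := Finset.univ.filter fun e => m e ≠ 0
    have hmT : m = ind T := by
      ext e
      rw [ind_apply]
      have := h e
      simp only [T, Finset.mem_filter, Finset.mem_univ, true_and]
      split_ifs <;> omega
    have hng : ¬ GoodIn a b g (Finset.univ \ T) := by
      intro hG
      rw [mem_support_iff, hmT] at hm
      exact hm (hf T hG)
    simp only [GoodIn, not_forall, not_exists, not_and, not_not, Finset.mem_sdiff, Finset.mem_univ, true_and] at hng
    obtain ⟨I, hg, hI, hc⟩ := hng
    have : fI a b (fun _ => (0 : K)) I = monomial (ind (cutOut a b I) + ind (cutIn a b I)) 1 := by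
      rw [← mul_one (1 : K), ← monomial_mul, monomial_ind, monomial_ind]
      simp [fI]
    have h1 : monomial m (coeff m f) = monomial (m - (ind (cutOut a b I) + ind (cutIn a b I))) (coeff m f) * 
        fI a b (fun _ => (0 : K)) I := by
      rw [this, monomial_mul, mul_one, tsub_add_cancel_of_le]
      intro e
      rw [hmT, Finsupp.add_apply, ind_apply, ind_apply, ind_apply]
      have := hc e
      by_cases h1 : e ∈ T
      · by_cases h2 : a e ∈ I <;> by_cases h3 : b e ∈ I <;> simp [h1, h2, h3, cutIn, cutOut]
      · have := hc e h1
        by_cases h2 : a e ∈ I 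
        · simp [cutIn, cutOut, h1, this.1 h2, h2]
        · have h3 : b e ∉ I := fun h => h2 (this.2 h)
          simp [cutIn, cutOut, h1, h2, h3]
    rw [h1]
    exact Ideal.mul_mem_left _ _ (Ideal.subset_span (Or.inr ⟨I, hg, hI, rfl⟩))


/-- the polynomial representing `X_i` -/
def Xp (K : Type*) [Field K] {n : ℕ} {E : Type*} [Fintype E] (a b : E → Fin n) (i : Fin n) :
    MvPolynomial E K :=
  (∑ e ∈ Finset.univ.filter fun e => a e = i, X e) -
      ∑ e ∈ Finset.univ.filter fun e => b e = i, X e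

/-- substitution -/
def theta (K : Type*) [Field K] {n : ℕ} {E : Type*} [Fintype E] (a b : E → Fin n) :
    MvPolynomial (Fin n) K →ₐ[K] MvPolynomial E K := aeval (Xp K a b)

/-- the map onto `Ψ` -/
def phi {K : Type*} [Field K] {n : ℕ} {E : Type*} [Fintype E] (a b : E → Fin n) (g : Fin n) (q : K) :
    MvPolynomial (Fin n) K →ₐ[K] PhiT K E a b (fun _ => q) g :=
  (Ideal.Quotient.mkₐ K (relIdealT K E a b (fun _ => q) g)).comp (theta K a b)

lemma phi_apply {K : Type*} [Field K] {n : ℕ} {E : Type*} [Fintype E] (a b : E → Fin n) (g : Fin n) (q : K)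
    (p : MvPolynomial (Fin n) K) : 
    phi a b g q p = Ideal.Quotient.mk (relIdealT K E a b (fun _ => q) g) (theta K a b p) := rfl

lemma phi_X {K : Type*} [Field K] {n : ℕ} {E : Type*} [Fintype E] (a b : E → Fin n) (g : Fin n) (q : K)
    (i : Fin n) : phi a b g q (X i) = XT K a b (fun _ => q) g i := by
  rw [phi_apply, theta, aeval_X]; rfl

lemma phi_range {K : Type*} [Field K] {n : ℕ} {E : Type*} [Fintype E] (a b : E → Fin n) (g : Fin n) (q : K) :
    (PsiT K a b (fun _ => q) g) = (phi a b g q).range := by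
  have : phi a b g q = aeval (XT K a b (fun _ => q) g) := by
    apply algHom_ext; intro i; rw [phi_X, aeval_X]
  rw [this, PsiT, Algebra.adjoin_range_eq_range_aeval]

lemma PhiT_finite {K : Type*} [Field K] {n : ℕ} {E : Type*} [Fintype E] (a b : E → Fin n) (g : Fin n) (q : K) :
    Module.Finite K (PhiT K E a b (fun _ => q) g) := by
  let mk := Ideal.Quotient.mkₐ K (relIdealT K E a b (fun _ => q) g)
  have hmk : Function.Surjective mk := Ideal.Quotient.mk_surjective
  have h1 : Algebra.adjoin K (Set.range fun e => mk (X e)) = ⊤ := by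
    have h0 : Algebra.adjoin K (Set.range (X : E → MvPolynomial E K)) = ⊤ := adjoin_range_X
    have := congrArg (Subalgebra.map mk) h0
    rw [AlgHom.map_adjoin, ← Set.range_comp, Algebra.map_top, (AlgHom.range_eq_top mk).2 hmk] at this
    exact this
  have h2 : (Subalgebra.toSubmodule (Algebra.adjoin K (Set.range fun e => mk (X e)))).FG := by
    apply fg_adjoin_of_finite (Set.finite_range _)
    rintro _ ⟨e, rfl⟩
    refine ⟨Polynomial.X ^ 2 - Polynomial.C q * Polynomial.X, ?_, ?_⟩
    · monicity!
    · rw [← Polynomial.aeval_def]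
      simp only [map_sub, map_pow, map_mul, Polynomial.aeval_X, Polynomial.aeval_C]
      have : mk (X e ^ 2 - C q * X e) = 0 := by
        apply Ideal.Quotient.eq_zero_iff_mem.2
        exact Ideal.subset_span (Or.inl ⟨e, rfl⟩)
      rw [map_sub, map_pow, map_mul] at this
      rw [← this, ← algebraMap_eq, AlgHom.commutes]
  rw [h1] at h2
  exact ⟨by simpa using h2⟩

/-- apolarity pairing -/
def pairL (K : Type*) [Field K] (V : Type*) [Fintype V] :
    MvPolynomial V K →ₗ[K] (MvPolynomial V K →ₗ[K] K) :=
  (basisMonomials V K).constr K (fun α => ((∏ i, (α i).factorial : ℕ) : K) • lcoeff K α)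

lemma pairL_monomial {K : Type*} [Field K] {V : Type*} [Fintype V] (α : V →₀ ℕ) 
    (p : MvPolynomial V K) : 
    pairL K V (monomial α 1) p = ((∏ i, (α i).factorial : ℕ) : K) * coeff α p := by
  have : (monomial α (1 : K)) = basisMonomials V K α := by simp
  rw [this, pairL, Module.Basis.constr_basis]
  simp [lcoeff_apply]

lemma pairL_inj {K : Type*} [Field K] [CharZero K] {V : Type*} [Fintype V] :
    Function.Injective (pairL K V) := by
  classical
  rw [← LinearMap.ker_eq_bot, LinearMap.ker_eq_bot']
  intro r hr
  ext α
  have h : ∀ r : MvPolynomial V K, pairL K V r (monomial α 1) = ((∏ i, (α i).factorial : ℕ) : K) * coeff α r := by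
    intro r
    have : (pairL K V).flip (monomial α 1) = ((∏ i, (α i).factorial : ℕ) : K) • lcoeff K α := by
      apply (basisMonomials V K).ext
      intro β
      simp only [coe_basisMonomials, LinearMap.flip_apply, pairL_monomial, LinearMap.smul_apply,
        lcoeff_apply, coeff_monomial, smul_eq_mul]
      by_cases h : α = β
      · subst h; simp
      · simp [h, Ne.symm h]
    exact LinearMap.congr_fun this r
  have h2 := h r
  rw [hr] at h2
  simp only [LinearMap.zero_apply] at h2
  have h3 : ((∏ i, (α i).factorial : ℕ) : K) ≠ 0 := by
    rw [Nat.cast_ne_zero, Finset.prod_ne_zero_iff]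
    exact fun i _ => Nat.factorial_ne_zero _
  exact (mul_eq_zero.1 h2.symm).resolve_left h3

lemma pairL_X_mul {K : Type*} [Field K] {V : Type*} [Fintype V] [DecidableEq V] (i : V)
    (r p : MvPolynomial V K) : pairL K V (X i * r) p = pairL K V r (pderiv i p) := by
  have : ((pairL K V).flip p).comp (LinearMap.mulLeft K (X i)) = (pairL K V).flip (pderiv i p) := by
    apply (basisMonomials V K).ext
    intro β
    simp only [coe_basisMonomials, LinearMap.comp_apply, LinearMap.flip_apply, LinearMap.mulLeft_apply]
    have : X i * monomial β (1 : K) = monomial (β + Finsupp.single i 1) 1 := by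
      rw [X, monomial_mul, mul_one, add_comm]
    rw [this, pairL_monomial, pairL_monomial, coeff_pderiv]
    have : ∏ j, ((β + Finsupp.single i 1 : V →₀ ℕ) j).factorial = (β i + 1) * ∏ j, (β j).factorial := by
      rw [← Finset.mul_prod_erase _ _ (Finset.mem_univ i), ← Finset.mul_prod_erase _ (fun j => (β j).factorial) (Finset.mem_univ i)]
      have : ∏ j ∈ Finset.univ.erase i, ((β + Finsupp.single i 1 : V →₀ ℕ) j).factorial = 
          ∏ j ∈ Finset.univ.erase i, (β j).factorial := by
        apply Finset.prod_congr rfl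
        intro j hj
        have := Finset.ne_of_mem_erase hj
        simp [Finsupp.single_apply, this.symm]
      rw [this]
      simp [Nat.factorial_succ]; ring
    rw [this]; push_cast; ring
  exact LinearMap.congr_fun this r

lemma pderiv_theta {K : Type*} [Field K] {n : ℕ} {E : Type*} [Fintype E] [DecidableEq E] (a b : E → Fin n)
    (e : E) (p : MvPolynomial (Fin n) K) :
    pderiv e (theta K a b p) = theta K a b (pderiv (a e) p - pderiv (b e) p) := by
  induction p using MvPolynomial.induction_on with
  | C c => rw [← algebraMap_eq, AlgHom.commutes]; simp [algebraMap_eq]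
  | add p r hp hr => simp only [map_add, hp, hr, map_sub]; ring
  | mul_X p i hp =>
    have h : pderiv e (Xp K a b i) = theta K a b (pderiv (a e) (X i) - pderiv (b e) (X i)) := by
      rw [Xp, map_sub, map_sum, map_sum, map_sub]
      congr 1
      · simp only [pderiv_X, Pi.single_apply]
        by_cases h : a e = i
        · simp [h]
        · simp [h, Ne.symm h]
      · simp only [pderiv_X, Pi.single_apply]
        by_cases h : b e = i
        · simp [h]
        · simp [h, Ne.symm h]
    have hX : theta K a b (X i) = Xp K a b i := by rw [theta, aeval_X]
    rw [map_mul, hX, pderiv_mul, hp, h, pderiv_mul, pderiv_mul]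
    simp only [map_sub, map_add, map_mul, hX]
    ring

lemma coeff_theta {K : Type*} [Field K] {n : ℕ} {E : Type*} [Fintype E] [DecidableEq E] (a b : E → Fin n)
    (T : Finset E) : ∀ p : MvPolynomial (Fin n) K,
    coeff (ind T) (theta K a b p) = pairL K (Fin n) (∏ e ∈ T, (X (a e) - X (b e))) p := by
  induction T using Finset.induction_on with
  | empty =>
    intro p
    have h1 : (1 : MvPolynomial (Fin n) K) = monomial 0 1 := rfl
    rw [Finset.prod_empty, h1, pairL_monomial]
    simp only [ind, Finset.sum_empty, Finsupp.coe_zero, Pi.zero_apply, Nat.factorial_zero, Finset.prod_const_one, Nat.cast_one, one_mul]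
    have : (constantCoeff : MvPolynomial E K →+* K).comp (theta K a b).toRingHom = constantCoeff := by
      apply ringHom_ext
      · intro r
        simp [theta]
      · intro i
        simp [theta, Xp]
    exact RingHom.congr_fun this p
  | insert e T he ih =>
    intro p
    have h1 : coeff (ind (insert e T)) (theta K a b p) = coeff (ind T) (pderiv e (theta K a b p)) := by
      rw [coeff_pderiv, ind_apply, if_neg he, ind, Finset.sum_insert he, add_comm]
      simp [ind]
    rw [h1, pderiv_theta, ih, Finset.prod_insert he, sub_mul, map_sub, map_sub, LinearMap.sub_apply,
      pairL_X_mul, pairL_X_mul]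

theorem L5 {K : Type*} [Field K] [CharZero K] {n : ℕ} {E : Type*} [Fintype E] [DecidableEq E] 
    (a b : E → Fin n) (g : Fin n) :
    Module.finrank K (Psp K a b g Finset.univ) ≤ 
      Module.finrank K (LinearMap.range (phi a b g (0 : K)).toLinearMap) := by
  have := PhiT_finite a b g (0 : K)
  let N := LinearMap.ker (phi a b g (0 : K)).toLinearMap
  have e1 := (LinearMap.quotKerEquivRange (phi a b g (0 : K)).toLinearMap)
  have : Module.Finite K (MvPolynomial (Fin n) K ⧸ N) := Module.Finite.equiv e1.symm
  have e2 := N.dualQuotEquivDualAnnihilator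
  have : Module.Finite K N.dualAnnihilator := Module.Finite.equiv e2
  rw [← e1.finrank_eq, ← Subspace.dual_finrank_eq (V := MvPolynomial (Fin n) K ⧸ _), e2.finrank_eq]
  have hmem : ∀ r ∈ Psp K a b g Finset.univ, pairL K (Fin n) r ∈ N.dualAnnihilator := by
    intro r hr
    have : Psp K a b g Finset.univ ≤ N.dualAnnihilator.comap (pairL K (Fin n)) := by
      rw [Psp, Submodule.span_le]
      rintro _ ⟨T, -, hG, rfl⟩
      rw [SetLike.mem_coe, Submodule.mem_comap, Submodule.mem_dualAnnihilator]
      intro p hp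
      rw [← coeff_theta]
      apply coeff_zero_case a b g T hG
      exact Ideal.Quotient.eq_zero_iff_mem.1 (LinearMap.mem_ker.1 hp)
    exact this hr
  apply LinearMap.finrank_le_finrank_of_injective (f := ((pairL K (Fin n)).domRestrict 
    (Psp K a b g Finset.univ)).codRestrict N.dualAnnihilator (fun r => hmem r r.2))
  intro r s h
  exact Subtype.ext (pairL_inj (congrArg Subtype.val h))

/-- outdegree -/
def score {n : ℕ} {E : Type*} [Fintype E] [DecidableEq E] (a b : E → Fin n) (U : Finset E) (v : Fin n) : ℤ :=
  ((Finset.univ.filter fun e => (if e ∈ U then a e else b e) = v).card : ℤ)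

lemma score_sum {n : ℕ} {E : Type*} [Fintype E] [DecidableEq E] (a b : E → Fin n) (U : Finset E) 
    (I : Finset (Fin n)) :
    ∑ v ∈ I, score a b U v = ((Finset.univ.filter fun e => (if e ∈ U then a e else b e) ∈ I).card : ℤ) := by
  simp only [score]
  rw [Finset.card_eq_sum_card_fiberwise (t := I) (f := fun e => if e ∈ U then a e else b e)]
  · push_cast
    apply Finset.sum_congr rfl
    intro v hv
    congr 2
    ext e
    simp only [Finset.mem_filter, Finset.mem_univ, true_and]
    constructor
    · intro h; exact ⟨h ▸ hv, h⟩
    · exact fun h => h.2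
  · intro e he
    simpa using he

lemma score_Sc {K : Type*} [Field K] {n : ℕ} {E : Type*} [Fintype E] [DecidableEq E] 
    (a b : E → Fin n) (g : Fin n) (q : K) (hq : q ≠ 0) (U : Finset E)
    (hU : ∀ I : Finset (Fin n), g ∈ I → I ≠ Finset.univ → 
      eval (fun e => if e ∈ U then q else 0) (fI a b (fun _ => q) I) = 0) :
    Sc a b g Finset.univ (score a b U) := by
  constructor
  · rw [score_sum]; simp
  · intro I
    rw [score_sum]
    have hsub : (Finset.univ.filter fun e => (if e ∈ U then a e else b e) ∈ I) ⊆ 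
        (Finset.univ.filter fun e => a e ∈ I ∨ b e ∈ I) := by
      intro e
      simp only [Finset.mem_filter, Finset.mem_univ, true_and]
      split_ifs <;> tauto
    split_ifs with h
    · have := hU I h.1 h.2
      rw [eval_fI_eq_zero] at this
      have hlt := Finset.card_lt_card (Finset.ssubset_iff_subset_ne.2 ⟨hsub, by
        intro heq
        rcases this with ⟨e, h1, h2, h3⟩ | ⟨e, h1, h2, h3⟩
        · have h4 : e ∉ U := by
            intro h; rw [if_pos h] at h3; exact hq h3
          have : e ∈ (Finset.univ.filter fun e => a e ∈ I ∨ b e ∈ I) := by simp [h1]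
          rw [← heq] at this
          simp [h4, h2] at this
        · have h4 : e ∈ U := by
            by_contra h; rw [if_neg h] at h3; exact hq h3.symm
          have : e ∈ (Finset.univ.filter fun e => a e ∈ I ∨ b e ∈ I) := by simp [h1]
          rw [← heq] at this
          simp [h4, h2] at this⟩)
      exact_mod_cast hlt
    · simpa using Finset.card_le_card hsub

lemma eval_Xp {K : Type*} [Field K] {n : ℕ} {E : Type*} [Fintype E] [DecidableEq E] 
    (a b : E → Fin n) (q : K) (U : Finset E) (i : Fin n) :
    eval (fun e => if e ∈ U then q else 0) (Xp K a b i) = 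
      q * ((score a b U i : K) - ((Finset.univ.filter fun e => b e = i).card : K)) := by
  simp only [Xp, map_sub, map_sum, score, Finset.card_filter, Finset.sum_filter]
  push_cast
  rw [← Finset.sum_sub_distrib, ← Finset.sum_sub_distrib, Finset.mul_sum]
  apply Finset.sum_congr rfl
  intro e _
  by_cases h : e ∈ U <;> simp only [h, if_true, if_false] <;> split_ifs <;> simp [h]

/-- idempotents -/
def eps {K : Type*} [Field K] {n : ℕ} {E : Type*} [Fintype E] [DecidableEq E] 
    (a b : E → Fin n) (g : Fin n) (q : K) (U : Finset E) : PhiT K E a b (fun _ => q) g :=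
  Ideal.Quotient.mk _ ((∏ e ∈ U, C q⁻¹ * X e) * ∏ e ∈ Finset.univ \ U, (1 - C q⁻¹ * X e))

lemma eps_sum {K : Type*} [Field K] {n : ℕ} {E : Type*} [Fintype E] [DecidableEq E] 
    (a b : E → Fin n) (g : Fin n) (q : K) : ∑ U : Finset E, eps a b g q U = 1 := by
  simp only [eps]
  rw [← map_sum, ← Finset.powerset_univ, ← Finset.prod_add]
  simp

lemma X_eps {K : Type*} [Field K] {n : ℕ} {E : Type*} [Fintype E] [DecidableEq E] 
    (a b : E → Fin n) (g : Fin n) (q : K) (hq : q ≠ 0) (U : Finset E) (e : E) :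
    Ideal.Quotient.mk (relIdealT K E a b (fun _ => q) g) (X e) * eps a b g q U = 
      (if e ∈ U then q else 0 : K) • eps a b g q U := by
  have hrel : X e ^ 2 - C q * X e ∈ relIdealT K E a b (fun _ => q) g := 
    Ideal.subset_span (Or.inl ⟨e, rfl⟩)
  have hC : (C q⁻¹ * C q : MvPolynomial E K) = 1 := by rw [← C_mul, inv_mul_cancel₀ hq, C_1]
  have hs : ∀ (c : K) (f : MvPolynomial E K), c • (Ideal.Quotient.mk (relIdealT K E a b (fun _ => q) g) f) = 
      Ideal.Quotient.mk (relIdealT K E a b (fun _ => q) g) (C c * f) := by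
    intro c f
    rw [C_mul']; rfl
  rw [eps, hs, ← map_mul, Ideal.Quotient.eq]
  split_ifs with h
  · rw [← Finset.mul_prod_erase _ _ h]
    set A := ∏ x ∈ U.erase e, C q⁻¹ * X x
    set B := ∏ e ∈ Finset.univ \ U, (1 - C q⁻¹ * X e : MvPolynomial E K)
    have : X e * (C q⁻¹ * X e * A * B) - C q * (C q⁻¹ * X e * A * B) = 
      (C q⁻¹ * A * B) * (X e ^ 2 - C q * X e) := by ring
    rw [this]
    exact Ideal.mul_mem_left _ _ hrel
  · have h' : e ∈ Finset.univ \ U := by simp [h]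
    rw [← Finset.mul_prod_erase _ _ h']
    set A := ∏ x ∈ U, C q⁻¹ * X x
    set B := ∏ e ∈ (Finset.univ \ U).erase e, (1 - C q⁻¹ * X e : MvPolynomial E K)
    have : X e * (A * ((1 - C q⁻¹ * X e) * B)) - C 0 * (A * ((1 - C q⁻¹ * X e) * B)) = 
      (- C q⁻¹ * A * B) * (X e ^ 2 - C q * X e) := by 
      rw [C_0]
      linear_combination (-(X e * A * B)) * hC
    rw [this]
    exact Ideal.mul_mem_left _ _ hrel

lemma mk_eps {K : Type*} [Field K] {n : ℕ} {E : Type*} [Fintype E] [DecidableEq E] 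
    (a b : E → Fin n) (g : Fin n) (q : K) (hq : q ≠ 0) (U : Finset E) (f : MvPolynomial E K) :
    Ideal.Quotient.mk (relIdealT K E a b (fun _ => q) g) f * eps a b g q U = 
      (eval (fun e => if e ∈ U then q else 0) f : K) • eps a b g q U := by
  induction f using MvPolynomial.induction_on with
  | C c =>
    rw [eval_C, eps, ← map_mul, C_mul']; rfl
  | add p r hp hr => rw [map_add, add_mul, hp, hr, map_add, add_smul]
  | mul_X p e hp => 
    rw [map_mul, mul_assoc, X_eps a b g q hq, mul_smul_comm, hp, map_mul, eval_X, smul_smul, mul_comm]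

theorem L3 {K : Type*} [Field K] {n : ℕ} {E : Type*} [Fintype E] [DecidableEq E] 
    (a b : E → Fin n) (g : Fin n) (q : K) (hq : q ≠ 0) :
    Module.finrank K (LinearMap.range (phi a b g q).toLinearMap) ≤ 
      Module.finrank K (Psp K a b g Finset.univ) := by
  classical
  have := PhiT_finite a b g q
  let G : Finset (Finset E) := Finset.univ.filter fun U => 
    ∀ I : Finset (Fin n), g ∈ I → I ≠ Finset.univ → 
      eval (fun e => if e ∈ U then q else 0) (fI a b (fun _ => q) I) = 0
  let S := G.image (score a b)
  have hS : S.card ≤ Module.finrank K (Psp K a b g Finset.univ) := by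
    apply card_le_finrank_Psp
    intro s hs
    simp only [S, Finset.mem_image] at hs
    obtain ⟨U, hU, rfl⟩ := hs
    exact score_Sc a b g q hq U (Finset.mem_filter.1 hU).2
  have hz : ∀ U, U ∉ G → eps a b g q U = 0 := by
    intro U hU
    simp only [G, Finset.mem_filter, Finset.mem_univ, true_and, not_forall] at hU
    obtain ⟨I, h1, h2, h3⟩ := hU
    have h4 := mk_eps a b g q hq U (fI a b (fun _ => q) I)
    have h5 : Ideal.Quotient.mk (relIdealT K E a b (fun _ => q) g) (fI a b (fun _ => q) I) = 0 :=
      Ideal.Quotient.eq_zero_iff_mem.2 (Ideal.subset_span (Or.inr ⟨I, h1, h2, rfl⟩))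
    rw [h5, zero_mul] at h4
    exact (smul_eq_zero.1 h4.symm).resolve_left h3
  let xs : (Fin n → ℤ) → Fin n → K := fun s i => 
    q * ((s i : K) - ((Finset.univ.filter fun e => b e = i).card : K))
  let η : (Fin n → ℤ) → PhiT K E a b (fun _ => q) g := fun s => ∑ U ∈ G with score a b U = s, eps a b g q U
  have hev : ∀ U p, eval (fun e => if e ∈ U then q else 0) (theta K a b p) = eval (xs (score a b U)) p := by
    intro U p
    have : (eval (fun e => if e ∈ U then q else 0)).comp (theta K a b).toRingHom = eval (xs (score a b U)) := by
      apply ringHom_ext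
      · intro r; simp [theta]
      · intro i
        simp only [theta, xs, AlgHom.toRingHom_eq_coe, RingHom.coe_comp, RingHom.coe_coe, Function.comp_apply, aeval_X, eval_X]
        exact eval_Xp a b q U i
    exact RingHom.congr_fun this p
  have hphi : ∀ p, phi a b g q p = ∑ s ∈ S, (eval (xs s) p) • η s := by
    intro p
    rw [← mul_one (phi a b g q p), ← eps_sum a b g q, Finset.mul_sum]
    have h1 : ∀ U, phi a b g q p * eps a b g q U = (eval (xs (score a b U)) p) • eps a b g q U := by
      intro U
      rw [phi_apply, mk_eps a b g q hq, hev]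
    simp only [h1]
    rw [← Finset.sum_subset (Finset.subset_univ G) (fun U _ hU => by rw [hz U hU, smul_zero])]
    rw [← Finset.sum_fiberwise_of_maps_to (s := G) (t := S) (g := score a b) 
      (fun U hU => Finset.mem_image_of_mem _ hU)]
    apply Finset.sum_congr rfl
    intro s _
    simp only [η]
    rw [Finset.smul_sum]
    apply Finset.sum_congr rfl
    intro U hU
    rw [(Finset.mem_filter.1 hU).2]
  refine le_trans ?_ hS
  have hle : LinearMap.range (phi a b g q).toLinearMap ≤ Submodule.span K ((S.image η : Finset _) : Set (PhiT K E a b (fun _ => q) g)) := by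
    rintro _ ⟨p, rfl⟩
    rw [AlgHom.toLinearMap_apply, hphi]
    apply Submodule.sum_mem
    intro s hs
    apply Submodule.smul_mem
    apply Submodule.subset_span
    exact Finset.mem_coe.2 (Finset.mem_image_of_mem _ hs)
  exact (Submodule.finrank_mono hle).trans ((finrank_span_finset_le_card _).trans Finset.card_image_le)


/-- polynomials of degree `< m` -/
def Rl (K σ : Type*) [Field K] (m : ℕ) : Submodule K (MvPolynomial σ K) :=
  restrictSupport K {d | d.degree < m}

lemma mem_Rl {K σ : Type*} [Field K] {m : ℕ} {p : MvPolynomial σ K} :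
    p ∈ Rl K σ m ↔ ∀ d, coeff d p ≠ 0 → d.degree < m := by
  rw [Rl, mem_restrictSupport_iff]
  constructor
  · intro h d hd
    exact h (Finset.mem_coe.2 (mem_support_iff.2 hd))
  · intro h d hd
    exact h d (mem_support_iff.1 (Finset.mem_coe.1 hd))

lemma Rl_succ {K σ : Type*} [Field K] (m : ℕ) : Rl K σ (m + 1) = restrictTotalDegree σ K m := by
  ext p
  rw [mem_Rl, mem_restrictTotalDegree, totalDegree, Finset.sup_le_iff]
  constructor
  · intro h d hd
    exact Nat.lt_succ_iff.1 (h d (mem_support_iff.1 hd))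
  · intro h d hd
    exact Nat.lt_succ_iff.2 (h d (mem_support_iff.2 hd))

lemma Rl_zero {K σ : Type*} [Field K] : Rl K σ 0 = ⊥ := by
  rw [eq_bot_iff]
  intro p hp
  rw [mem_Rl] at hp
  rw [Submodule.mem_bot]
  ext d
  by_contra h
  exact absurd (hp d h) (by omega)

lemma Rl_mono {K σ : Type*} [Field K] {m k : ℕ} (h : m ≤ k) : Rl K σ m ≤ Rl K σ k := by
  intro p hp
  rw [mem_Rl] at hp ⊢
  intro d hd
  exact (hp d hd).trans_le h

lemma Rl_finite {K σ : Type*} [Field K] [Finite σ] (m : ℕ) : Module.Finite K (Rl K σ m) := by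
  have h : Rl K σ m ≤ restrictTotalDegree σ K m := by
    rw [← Rl_succ]; exact Rl_mono (by omega)
  exact Submodule.finiteDimensional_of_le h

lemma theta_homog {K : Type*} [Field K] {n : ℕ} {E : Type*} [Fintype E] (a b : E → Fin n) 
    (p : MvPolynomial (Fin n) K) (m : ℕ) (hp : p.IsHomogeneous m) : (theta K a b p).IsHomogeneous m := by
  have := hp.aeval (Xp K a b) (n := 1) (fun i => by
    apply IsHomogeneous.sub
    · exact IsHomogeneous.sum _ _ _ (fun e _ => isHomogeneous_X _ _)
    · exact IsHomogeneous.sum _ _ _ (fun e _ => isHomogeneous_X _ _))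
  rwa [one_mul] at this

lemma homog_mem_Rl {K σ : Type*} [Field K] {p : MvPolynomial σ K} {k m : ℕ} (hp : p.IsHomogeneous k)
    (hk : k < m) : p ∈ Rl K σ m := by
  rw [mem_Rl]
  intro d hd
  by_contra h
  apply hd
  apply hp.coeff_eq_zero
  omega

lemma theta_Rl {K : Type*} [Field K] {n : ℕ} {E : Type*} [Fintype E] (a b : E → Fin n) 
    (p : MvPolynomial (Fin n) K) (m : ℕ) (hp : p ∈ Rl K _ m) : theta K a b p ∈ Rl K _ m := by
  rw [← sum_homogeneousComponent p, map_sum]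
  apply Submodule.sum_mem
  intro k _
  by_cases hk : k < m
  · exact homog_mem_Rl (theta_homog a b _ k (homogeneousComponent_isHomogeneous k p)) hk
  · have : homogeneousComponent k p = 0 := by
      ext d
      rw [coeff_homogeneousComponent, coeff_zero]
      split_ifs with h
      · by_contra h2
        have := mem_Rl.1 hp d h2
        omega
      · rfl
    rw [this, map_zero]; exact Submodule.zero_mem _

lemma FkT_eq {K : Type*} [Field K] {n : ℕ} {E : Type*} [Fintype E] (a b : E → Fin n) (g : Fin n) (q : K)
    (k : ℕ) : FkT K a b (fun _ => q) g k = (Rl K (Fin n) (k + 1)).map (phi a b g q).toLinearMap := by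
  apply le_antisymm
  · rw [FkT, Submodule.span_le]
    rintro _ ⟨α, hα, rfl⟩
    refine ⟨∏ i, X i ^ α i, ?_, ?_⟩
    · refine homog_mem_Rl (k := ∑ i, α i) ?_ (by omega)
      apply IsHomogeneous.prod
      intro i _
      exact isHomogeneous_X_pow _ _
    · simp [map_prod, phi_X]
  · rintro _ ⟨p, hp, rfl⟩
    rw [AlgHom.toLinearMap_apply, p.as_sum, map_sum]
    apply Submodule.sum_mem
    intro d hd
    have h1 : monomial d (coeff d p) = (coeff d p) • ∏ i, X i ^ d i := by
      rw [monomial_eq, Finsupp.prod_fintype _ _ (by simp), C_mul']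
    rw [h1, map_smul, map_prod]
    apply Submodule.smul_mem
    apply Submodule.subset_span
    refine ⟨d, ?_, ?_⟩
    · have := mem_Rl.1 hp d (mem_support_iff.1 hd)
      rw [Finsupp.degree_eq_sum] at this
      omega
    · simp [phi_X]

/-- the key submodules -/
def Bm {K : Type*} [Field K] {n : ℕ} {E : Type*} [Fintype E] (a b : E → Fin n) (g : Fin n) (q : K)
    (m : ℕ) : Submodule K (MvPolynomial (Fin n) K) :=
  Rl K (Fin n) (m + 1) ⊓ ((Rl K (Fin n) m).map (phi a b g q).toLinearMap).comap (phi a b g q).toLinearMap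

lemma lemQ {K : Type*} [Field K] {n : ℕ} {E : Type*} [Fintype E] [DecidableEq E] (a b : E → Fin n) 
    (g : Fin n) (q : K) (m : ℕ) (p : MvPolynomial (Fin n) K) (hp : p ∈ Rl K _ (m + 1))
    (h : MvPolynomial E K) (hh : h ∈ Rl K _ m) 
    (hph : phi a b g q p = Ideal.Quotient.mk _ h) (T : Finset E) 
    (hT : GoodIn a b g (Finset.univ \ T)) (hm : T.card = m) : coeff (ind T) (theta K a b p) = 0 := by
  have h1 : coeff (ind T) h = 0 := by
    by_contra hc
    have := mem_Rl.1 hh _ hc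
    rw [ind_degree] at this
    omega
  have h2 : theta K a b p - h ∈ Rl K _ (m + 1) := 
    Submodule.sub_mem _ (theta_Rl a b p _ hp) (Rl_mono (by omega) hh)
  rw [Rl_succ, mem_restrictTotalDegree, ← hm] at h2
  have := L1 a b g q T hT (theta K a b p - h) (Ideal.Quotient.eq.1 hph) h2
  rwa [coeff_sub, h1, sub_zero] at this

lemma lemP {K : Type*} [Field K] {n : ℕ} {E : Type*} [Fintype E] [DecidableEq E] (a b : E → Fin n) 
    (g : Fin n) (m : ℕ) (p : MvPolynomial (Fin n) K) (hp : p ∈ Rl K _ (m + 1))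
    (h : ∀ T : Finset E, GoodIn a b g (Finset.univ \ T) → T.card = m → coeff (ind T) (theta K a b p) = 0) :
    p ∈ Bm a b g (0 : K) m := by
  have h1 : p - homogeneousComponent m p ∈ Rl K _ m := by
    rw [mem_Rl]
    intro d hd
    rw [coeff_sub, coeff_homogeneousComponent] at hd
    split_ifs at hd with h2
    · simp at hd
    · rw [sub_zero] at hd
      have := mem_Rl.1 hp d hd
      omega
  have h2 : phi a b g (0 : K) (homogeneousComponent m p) = 0 := by
    rw [phi_apply]
    apply Ideal.Quotient.eq_zero_iff_mem.2
    apply L2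
    intro T hT
    by_cases hm : T.card = m
    · have h3 := h T hT hm
      have h4 : coeff (ind T) (theta K a b (p - homogeneousComponent m p)) = 0 := by
        by_contra hc
        have := mem_Rl.1 (theta_Rl a b _ m h1) _ hc
        rw [ind_degree] at this
        omega
      rw [map_sub, coeff_sub, h3, zero_sub, neg_eq_zero] at h4
      exact h4
    · apply (theta_homog a b _ m (homogeneousComponent_isHomogeneous m p)).coeff_eq_zero
      rwa [ind_degree]
  refine ⟨hp, ?_⟩
  refine ⟨_, h1, ?_⟩
  rw [AlgHom.toLinearMap_apply, AlgHom.toLinearMap_apply, map_sub, h2, sub_zero]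

lemma Bm_le {K : Type*} [Field K] {n : ℕ} {E : Type*} [Fintype E] [DecidableEq E] (a b : E → Fin n) 
    (g : Fin n) (q : K) (m : ℕ) : Bm a b g q m ≤ Bm a b g (0 : K) m := by
  rintro p ⟨hp, p', hp', hpp⟩
  apply lemP a b g m p hp
  intro T hT hm
  exact lemQ a b g q m p hp (theta K a b p') (theta_Rl a b _ _ hp') hpp.symm T hT hm

lemma finrank_map_inf_ker {K M N : Type*} [Field K] [AddCommGroup M] [Module K M] [AddCommGroup N] [Module K N]
    (f : M →ₗ[K] N) (W : Submodule K M) [Module.Finite K W] :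
    Module.finrank K (W.map f) + Module.finrank K (W ⊓ LinearMap.ker f : Submodule K M) = Module.finrank K W := by
  have := LinearMap.finrank_range_add_finrank_ker (f.domRestrict W)
  rw [LinearMap.range_domRestrict, LinearMap.ker_domRestrict] at this
  rw [← this]
  congr 1
  rw [← Submodule.finrank_map_subtype_eq, Submodule.map_comap_subtype]

/-- dimension of the filtration -/
def Dm {K : Type*} [Field K] {n : ℕ} {E : Type*} [Fintype E] (a b : E → Fin n) (g : Fin n) (q : K)
    (m : ℕ) : ℕ := Module.finrank K ((Rl K (Fin n) m).map (phi a b g q).toLinearMap)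

lemma Dm_succ {K : Type*} [Field K] {n : ℕ} {E : Type*} [Fintype E] (a b : E → Fin n) (g : Fin n) (q : K)
    (m : ℕ) : Dm a b g q (m + 1) + Module.finrank K (Bm a b g q m) = 
      Dm a b g q m + Module.finrank K (Rl K (Fin n) (m + 1)) := by
  have := Rl_finite (K := K) (σ := Fin n) (m + 1)
  have : Module.Finite K (Bm a b g q m) := Submodule.finiteDimensional_of_le (S₂ := Rl K (Fin n) (m + 1)) inf_le_left
  have h1 := finrank_map_inf_ker (phi a b g q).toLinearMap (Rl K (Fin n) (m + 1))
  have h2 := finrank_map_inf_ker (phi a b g q).toLinearMap (Bm a b g q m)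
  have h3 : (Bm a b g q m).map (phi a b g q).toLinearMap = (Rl K (Fin n) m).map (phi a b g q).toLinearMap := by
    apply le_antisymm
    · rintro _ ⟨p, ⟨-, hp⟩, rfl⟩
      exact hp
    · rintro _ ⟨p, hp, rfl⟩
      exact ⟨p, ⟨Rl_mono (by omega) hp, ⟨p, hp, rfl⟩⟩, rfl⟩
  have h4 : Bm a b g q m ⊓ LinearMap.ker (phi a b g q).toLinearMap = 
      Rl K (Fin n) (m + 1) ⊓ LinearMap.ker (phi a b g q).toLinearMap := by
    apply le_antisymm
    · exact inf_le_inf_right _ inf_le_left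
    · rintro p ⟨h, h'⟩
      refine ⟨⟨h, ?_⟩, h'⟩
      rw [SetLike.mem_coe, Submodule.mem_comap, LinearMap.mem_ker.1 h']
      exact Submodule.zero_mem _
  rw [h3, h4] at h2
  simp only [Dm]
  omega

lemma exists_M {K : Type*} [Field K] {n : ℕ} {E : Type*} [Fintype E] (a b : E → Fin n) (g : Fin n) (q : K) :
    ∃ M, ∀ m, M ≤ m → (Rl K (Fin n) m).map (phi a b g q).toLinearMap = LinearMap.range (phi a b g q).toLinearMap := by
  have := PhiT_finite a b g q
  obtain ⟨M, hM⟩ := monotone_stabilizes_iff_noetherian.2 (inferInstance : IsNoetherian K (PhiT K E a b (fun _ => q) g))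
    ⟨fun m => (Rl K (Fin n) m).map (phi a b g q).toLinearMap, fun i j h => Submodule.map_mono (Rl_mono h)⟩
  refine ⟨M, fun m hm => ?_⟩
  apply le_antisymm
  · exact LinearMap.map_le_range
  rintro _ ⟨p, rfl⟩
  have hp : p ∈ Rl K (Fin n) (max m (p.totalDegree + 1)) := by
    apply Rl_mono (le_max_right _ _)
    rw [Rl_succ, mem_restrictTotalDegree]
  have e1 : (Rl K (Fin n) M).map (phi a b g q).toLinearMap =
      (Rl K (Fin n) m).map (phi a b g q).toLinearMap := hM m hm
  have e2 : (Rl K (Fin n) M).map (phi a b g q).toLinearMap =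
      (Rl K (Fin n) (max m (p.totalDegree + 1))).map (phi a b g q).toLinearMap :=
    hM (max m (p.totalDegree + 1)) (hm.trans (le_max_left _ _))
  rw [← e1, e2]
  exact ⟨p, hp, rfl⟩

theorem main_eq {K : Type*} [Field K] [CharZero K] {n : ℕ} {E : Type*} [Fintype E] [DecidableEq E] (a b : E → Fin n) 
    (g : Fin n) (q : K) : (∀ m, Dm a b g q m = Dm a b g (0 : K) m) ∧ ∀ m, Bm a b g q m = Bm a b g (0 : K) m := by
  by_cases hq : q = 0
  · subst hq; exact ⟨fun _ => rfl, fun _ => rfl⟩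
  have hfin : ∀ m, Module.Finite K (Bm a b g (0 : K) m) := fun m =>
    have := Rl_finite (K := K) (σ := Fin n) (m + 1)
    Submodule.finiteDimensional_of_le (S₂ := Rl K (Fin n) (m + 1)) inf_le_left
  have hB : ∀ m, Module.finrank K (Bm a b g q m) ≤ Module.finrank K (Bm a b g (0 : K) m) := fun m =>
    have := hfin m
    Submodule.finrank_mono (Bm_le a b g q m)
  have hstep : ∀ m, Dm a b g q m + Dm a b g (0 : K) (m + 1) ≤ Dm a b g q (m + 1) + Dm a b g (0 : K) m := by
    intro m
    have h1 := Dm_succ a b g q m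
    have h2 := Dm_succ a b g (0 : K) m
    have := hB m
    omega
  have hmono : ∀ m k, Dm a b g q m + Dm a b g (0 : K) (m + k) ≤ Dm a b g q (m + k) + Dm a b g (0 : K) m := by
    intro m k
    induction k with
    | zero => simp
    | succ k ih =>
      have := hstep (m + k)
      rw [← add_assoc]
      omega
  have h0 : ∀ q : K, Dm a b g q 0 = 0 := by
    intro q
    rw [Dm, Rl_zero, Submodule.map_bot]; simp
  obtain ⟨M1, hM1⟩ := exists_M a b g q
  obtain ⟨M2, hM2⟩ := exists_M a b g (0 : K)
  have hbig : ∀ m, M1 ≤ m → M2 ≤ m → Dm a b g q m ≤ Dm a b g (0 : K) m := by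
    intro m h1 h2
    rw [Dm, Dm, hM1 m h1, hM2 m h2]
    exact (L3 a b g q hq).trans (L5 a b g)
  have hD : ∀ m, Dm a b g q m = Dm a b g (0 : K) m := by
    intro m
    have h1 := hmono 0 m
    have h2 := hmono m (M1 + M2)
    have h3 := hbig (m + (M1 + M2)) (by omega) (by omega)
    simp only [h0, zero_add, add_zero] at h1
    omega
  refine ⟨hD, fun m => ?_⟩
  have := hfin m
  apply Submodule.eq_of_le_of_finrank_le (Bm_le a b g q m)
  have h1 := Dm_succ a b g q m
  have h2 := Dm_succ a b g (0 : K) m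
  have h3 := hD m
  have h4 := hD (m + 1)
  omega

/-- For the Hecke deformation of the spanning-tree algebra: (i) the
filtration induced by the `X_i^T` coincides with the one induced from `Φ^T_{G,q}` by total
degree, and (ii) its Hilbert polynomial coincides with that of the undeformed algebra
`C^T_G = Ψ^T_{G,0}`. -/
theorem heckeT_filtration_and_hilbert
    {K : Type*} [Field K] [CharZero K] {n : ℕ} {E : Type*} [Fintype E] [DecidableEq E]
    (a b : E → Fin n) (g : Fin n)
    (hab : ∀ e, a e < b e) (hconn : IsConnectedGraph a b) (q : K) :
    (∀ k : ℕ, FkT K a b (fun _ => q) g k =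
      (PsiT K a b (fun _ => q) g).toSubmodule ⊓
        Submodule.map (Ideal.Quotient.mkₐ K (relIdealT K E a b (fun _ => q) g)).toLinearMap
          (MvPolynomial.restrictTotalDegree E K k)) ∧
    (∀ k : ℕ, Module.finrank K (FkT K a b (fun _ => q) g k) =
      Module.finrank K (FkT K a b (fun _ => (0 : K)) g k)) := by
  obtain ⟨hD, hB⟩ := main_eq a b g q
  constructor
  · intro k
    rw [FkT_eq, phi_range, ← Rl_succ]
    apply le_antisymm
    · rintro _ ⟨p, hp, rfl⟩
      exact ⟨⟨p, rfl⟩, ⟨theta K a b p, theta_Rl a b p _ hp, rfl⟩⟩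
    · rintro y ⟨⟨p, hp⟩, ⟨h, hh, hy⟩⟩
      have key : ∀ m, ∀ p : MvPolynomial (Fin n) K, p ∈ Rl K (Fin n) m → phi a b g q p = y → 
          y ∈ (Rl K (Fin n) (k + 1)).map (phi a b g q).toLinearMap := by
        intro m
        induction m with
        | zero =>
          intro p hp hpy
          exact ⟨p, Rl_mono (by omega) hp, hpy⟩
        | succ m ih =>
          intro p hp hpy
          by_cases hm : m ≤ k
          · exact ⟨p, Rl_mono (by omega) hp, hpy⟩
          · have h1 : p ∈ Bm a b g (0 : K) m := by
              apply lemP a b g m p hp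
              intro T hT hTm
              exact lemQ a b g q m p hp h (Rl_mono (by omega) hh) (hpy.trans hy.symm) T hT hTm
            rw [← hB] at h1
            obtain ⟨-, p', hp', hpp⟩ := h1
            exact ih p' hp' (hpp.trans hpy)
      exact key (p.totalDegree + 1) p (by rw [Rl_succ, mem_restrictTotalDegree]) hp
  · intro k
    rw [FkT_eq, FkT_eq]
    exact hD (k + 1)

end
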